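/- Let d, e ≥ 2 be integers. Then there exists a quasisymmetric homeomorphism φ : ℝ/ℤ → ℝ/ℤ (with respect to the quotient metric) such that φ maps the set of d-adic rationals {p/d^n mod 1 : p ∈ ℤ, n ∈ ℕ} onto the set of e-adic rationals {q/e^m mod 1 : q ∈ ℤ, m ∈ ℕ}. -/

import Mathlib

noncomputable section

open Set

/-- The circle `ℝ/ℤ`. -/
abbrev 𝕊 : Type := AddCircle (1 : ℝ)

/-- The natural projection from `ℝ` to the circle `ℝ/ℤ`. -/
def tc (x : ℝ) : 𝕊 := (x : 𝕊)

/-- The closed arc on the circle from `a` to `b`, traversed in the positive direction;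
arcs are parametrized by real lifts `a ≤ b ≤ a + 1` of their endpoints. -/
def cArc (a b : ℝ) : Set 𝕊 := tc '' Set.Icc a b

/-- The open arc on the circle from `a` to `b` (the interior of `cArc a b`). -/
def oArc (a b : ℝ) : Set 𝕊 := tc '' Set.Ioo a b

/-- The multiplication-by-`d` map `σ_d : ℝ/ℤ → ℝ/ℤ`, `σ_d t = d·t`. -/
def sigmaC (d : ℕ) (x : 𝕊) : 𝕊 := d • x

open scoped NNReal

/-- The set of `d`-adic rational points of the circle `ℝ/ℤ`:
`{p/d^n mod 1 : p ∈ ℤ, n ∈ ℕ}`. -/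
def adicPoints (d : ℕ) : Set 𝕊 := {x | ∃ (p : ℤ) (n : ℕ), x = tc ((p : ℝ) / d ^ n)}

/-- A self-map `φ` of the circle (with the quotient metric) is quasisymmetric: there is an
increasing homeomorphism `η : [0,∞) → [0,∞)` such that
`dist (φ x) (φ y) ≤ η (dist x y / dist x z) * dist (φ x) (φ z)` whenever `x ≠ z`. -/
def QuasiSymmetric (φ : 𝕊 → 𝕊) : Prop :=
  ∃ η : ℝ≥0 ≃ₜ ℝ≥0, StrictMono η ∧
    ∀ x y z : 𝕊, x ≠ z →
      dist (φ x) (φ y) ≤ (η (Real.toNNReal (dist x y / dist x z)) : ℝ) * dist (φ x) (φ z)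

/-- The strict partial order on the plane given by the open cone of vectors whose slope lies
strictly between `1/2` and `2`. -/
def ConeLT (p q : ℝ × ℝ) : Prop :=
  q.1 - p.1 < 2 * (q.2 - p.2) ∧ q.2 - p.2 < 2 * (q.1 - p.1)

/-- A map of the line all of whose difference quotients lie in `[1/2, 2]`. -/
def SlopeBounded (f : ℝ → ℝ) : Prop :=
  ∀ x y, x ≤ y → y - x ≤ 2 * (f y - f x) ∧ f y - f x ≤ 2 * (y - x)

/-- The real numbers of the form `p / d ^ n`. -/
def adicReals (d : ℕ) : Set ℝ := {x | ∃ (p : ℤ) (n : ℕ), x = (p : ℝ) / d ^ n}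

theorem ConeLT.swap {p q : ℝ × ℝ} (h : ConeLT p q) : ConeLT p.swap q.swap :=
  ⟨h.2, h.1⟩

theorem IsChain.coneLT_swap {F : Set (ℝ × ℝ)} (hF : IsChain ConeLT F) :
    IsChain ConeLT (Prod.swap '' F) := by
  rintro _ ⟨p, hp, rfl⟩ _ ⟨q, hq, rfl⟩ hne
  exact (hF hp hq fun h => hne (h ▸ rfl)).imp ConeLT.swap ConeLT.swap

theorem IsChain.exists_coneLT_insert {F : Finset (ℝ × ℝ)} (hF : IsChain ConeLT (F : Set (ℝ × ℝ)))
    {B : Set ℝ} (hB : Dense B) (x : ℝ) (hx : ∀ p ∈ F, p.1 ≠ x) :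
    ∃ y ∈ B, IsChain ConeLT (insert (x, y) (F : Set (ℝ × ℝ))) := by
  let lo : ℝ × ℝ → ℝ := fun p => p.2 + min ((x - p.1) / 2) (2 * (x - p.1))
  let hi : ℝ × ℝ → ℝ := fun p => p.2 + max ((x - p.1) / 2) (2 * (x - p.1))
  have key : ∀ p ∈ F, ∀ q ∈ F, lo p < hi q := by
    intro p hp q hq
    have hpx := hx p hp
    have hqx := hx q hq
    have hpq : (p.1 = q.1 ∧ p.2 = q.2) ∨ ConeLT p q ∨ ConeLT q p := by
      by_cases h : p = q
      · exact Or.inl (Prod.ext_iff.1 h)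
      · exact Or.inr (hF hp hq h)
    simp only [lo, hi]
    rcases lt_or_gt_of_ne hpx with h1 | h1 <;> rcases lt_or_gt_of_ne hqx with h2 | h2 <;>
      rcases hpq with ⟨h3, h4⟩ | ⟨h3, h4⟩ | ⟨h3, h4⟩ <;>
      rcases min_cases ((x - p.1) / 2) (2 * (x - p.1)) with h5 | h5 <;>
      rcases max_cases ((x - q.1) / 2) (2 * (x - q.1)) with h6 | h6 <;>
      linarith
  obtain ⟨m, hm1, hm2⟩ := Order.exists_between_finsets (F.image lo) (F.image hi) (by
    simp only [Finset.mem_image]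
    rintro _ ⟨p, hp, rfl⟩ _ ⟨q, hq, rfl⟩
    exact key p hp q hq)
  have hopen : IsOpen (⋂ p ∈ F, Set.Ioo (lo p) (hi p)) :=
    isOpen_biInter_finset fun p _ => isOpen_Ioo
  obtain ⟨y, hyU, hyB⟩ := hB.inter_open_nonempty _ hopen ⟨m, by
    simp only [Set.mem_iInter]
    exact fun p hp => ⟨hm1 _ (Finset.mem_image_of_mem _ hp), hm2 _ (Finset.mem_image_of_mem _ hp)⟩⟩
  simp only [Set.mem_iInter] at hyU
  refine ⟨y, hyB, hF.insert fun p hp _ => ?_⟩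
  obtain ⟨h1, h2⟩ := hyU p hp
  simp only [lo, hi] at h1 h2
  rcases lt_or_gt_of_ne (hx p hp) with h | h
  · rw [min_eq_left (by linarith)] at h1
    rw [max_eq_right (by linarith)] at h2
    exact Or.inr ⟨by dsimp only; linarith, by dsimp only; linarith⟩
  · rw [min_eq_right (by linarith)] at h1
    rw [max_eq_left (by linarith)] at h2
    exact Or.inl ⟨by dsimp only; linarith, by dsimp only; linarith⟩

/-- Finite chains for the cone order with vertices in `A ×ˢ B`, ordered by inclusion. -/
abbrev FiniteConeChain (A B : Set ℝ) : Type :=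
  {F : Finset (ℝ × ℝ) // (F : Set (ℝ × ℝ)) ⊆ A ×ˢ B ∧ IsChain ConeLT (F : Set (ℝ × ℝ))}

theorem FiniteConeChain.exists_le_fst {A B : Set ℝ} (hB : Dense B) (F : FiniteConeChain A B)
    {a : ℝ} (ha : a ∈ A) : ∃ F', F ≤ F' ∧ ∃ p ∈ F'.1, p.1 = a := by
  by_cases h : ∃ p ∈ F.1, p.1 = a
  · exact ⟨F, le_rfl, h⟩
  · push Not at h
    obtain ⟨b, hb, hc⟩ := F.2.2.exists_coneLT_insert hB a h
    refine ⟨⟨insert (a, b) F.1, ?_, ?_⟩, Finset.subset_insert _ _, (a, b),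
      Finset.mem_insert_self _ _, rfl⟩
    · rw [Finset.coe_insert]
      exact Set.insert_subset ⟨ha, hb⟩ F.2.1
    · rwa [Finset.coe_insert]

/-- The finite cone chain obtained by exchanging the two coordinates. -/
def FiniteConeChain.swap {A B : Set ℝ} (F : FiniteConeChain A B) : FiniteConeChain B A :=
  ⟨F.1.image Prod.swap, by
    rw [Finset.coe_image]
    rintro _ ⟨p, hp, rfl⟩
    exact ⟨(F.2.1 hp).2, (F.2.1 hp).1⟩, by
    rw [Finset.coe_image]
    exact F.2.2.coneLT_swap⟩

theorem FiniteConeChain.exists_le_snd {A B : Set ℝ} (hA : Dense A) (F : FiniteConeChain A B)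
    {b : ℝ} (hb : b ∈ B) : ∃ F', F ≤ F' ∧ ∃ p ∈ F'.1, p.2 = b := by
  obtain ⟨F', hle, p, hp, hpb⟩ := F.swap.exists_le_fst hA hb
  refine ⟨F'.swap, fun q hq => ?_, p.swap, Finset.mem_image_of_mem _ hp, hpb⟩
  exact Finset.mem_image.2 ⟨q.swap, hle (Finset.mem_image_of_mem _ hq), q.swap_swap⟩

/-- Back and forth: a finite cone chain extends to a chain projecting onto both `A` and `B`. -/
theorem exists_coneChain {A B : Set ℝ} (hAc : A.Countable) (hBc : B.Countable)
    (hA : Dense A) (hB : Dense B) (F : FiniteConeChain A B) :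
    ∃ G : Set (ℝ × ℝ), (F.1 : Set (ℝ × ℝ)) ⊆ G ∧ G ⊆ A ×ˢ B ∧ IsChain ConeLT G ∧
      (∀ a ∈ A, ∃ b, (a, b) ∈ G) ∧ ∀ b ∈ B, ∃ a, (a, b) ∈ G := by
  have := hAc.to_subtype
  have := hBc.to_subtype
  let _ : Encodable A := Encodable.ofCountable A
  let _ : Encodable B := Encodable.ofCountable B
  let D : A ⊕ B → Order.Cofinal (FiniteConeChain A B) := Sum.elim
    (fun a => ⟨{F' | ∃ p ∈ F'.1, p.1 = a}, fun F' => by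
      obtain ⟨F'', hle, h⟩ := F'.exists_le_fst hB a.2
      exact ⟨F'', h, hle⟩⟩)
    (fun b => ⟨{F' | ∃ p ∈ F'.1, p.2 = b}, fun F' => by
      obtain ⟨F'', hle, h⟩ := F'.exists_le_snd hA b.2
      exact ⟨F'', h, hle⟩⟩)
  let I := Order.idealOfCofinals F D
  refine ⟨{p | ∃ F' ∈ I, p ∈ F'.1}, fun p hp => ⟨F, Order.mem_idealOfCofinals F D, hp⟩, ?_, ?_,
    ?_, ?_⟩
  · rintro p ⟨F', -, hp⟩
    exact F'.2.1 hp
  · rintro p ⟨F₁, h₁, hp⟩ q ⟨F₂, h₂, hq⟩ hne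
    obtain ⟨F₃, -, h13, h23⟩ := I.directed _ h₁ _ h₂
    exact F₃.2.2 (h13 hp) (h23 hq) hne
  · intro a ha
    obtain ⟨F', ⟨p, hp, hpa⟩, hF'⟩ := Order.cofinal_meets_idealOfCofinals F D (Sum.inl ⟨a, ha⟩)
    refine ⟨p.2, F', hF', ?_⟩
    dsimp only at hpa
    rwa [← hpa]
  · intro b hb
    obtain ⟨F', ⟨p, hp, hpb⟩, hF'⟩ := Order.cofinal_meets_idealOfCofinals F D (Sum.inr ⟨b, hb⟩)
    refine ⟨p.1, F', hF', ?_⟩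
    dsimp only at hpb
    rwa [← hpb]

namespace SlopeBounded

variable {f : ℝ → ℝ}

theorem abs_sub_le (hf : SlopeBounded f) (x y : ℝ) :
    |x - y| ≤ 2 * |f x - f y| ∧ |f x - f y| ≤ 2 * |x - y| := by
  wlog h : y ≤ x generalizing x y
  · rw [abs_sub_comm x, abs_sub_comm (f x)]
    exact this y x (le_of_not_ge h)
  have h1 := hf y x h
  rw [abs_of_nonneg (sub_nonneg.2 h), abs_of_nonneg (by linarith)]
  exact h1

theorem injective (hf : SlopeBounded f) : Function.Injective f := by
  intro x y h
  have := (hf.abs_sub_le x y).1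
  rw [h, sub_self, abs_zero, mul_zero] at this
  exact sub_eq_zero.1 (abs_eq_zero.1 (le_antisymm this (abs_nonneg _)))

theorem le_iff_le (hf : SlopeBounded f) {x y : ℝ} : f x ≤ f y ↔ x ≤ y := by
  constructor <;> intro h
  · by_contra! h'
    linarith [(hf y x h'.le).1]
  · linarith [(hf x y h).1]

theorem lt_iff_lt (hf : SlopeBounded f) {x y : ℝ} : f x < f y ↔ x < y :=
  lt_iff_lt_of_le_iff_le hf.le_iff_le

end SlopeBounded

/-- Two countable dense subsets of the line containing `0` and `1` are exchanged by a
bi-Lipschitz homeomorphism fixing `0` and `1`. -/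
theorem exists_slopeBounded {A B : Set ℝ} (hAc : A.Countable) (hBc : B.Countable)
    (hA : Dense A) (hB : Dense B) (hA0 : 0 ∈ A) (hA1 : 1 ∈ A) (hB0 : 0 ∈ B) (hB1 : 1 ∈ B) :
    ∃ f : ℝ → ℝ, SlopeBounded f ∧ Function.Surjective f ∧ f 0 = 0 ∧ f 1 = 1 ∧
      ∀ x, f x ∈ B ↔ x ∈ A := by
  let F : FiniteConeChain A B := ⟨{(0, 0), (1, 1)}, by
    rw [Finset.coe_pair]
    rintro _ (rfl | rfl)
    exacts [⟨hA0, hB0⟩, ⟨hA1, hB1⟩], by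
    rw [Finset.coe_pair]
    refine IsChain.insert (by simp) ?_
    rintro _ rfl -
    exact Or.inl ⟨by norm_num, by norm_num⟩⟩
  obtain ⟨G, hFG, hGAB, hG, hGA, hGB⟩ := exists_coneChain hAc hBc hA hB F
  have hGslope : ∀ p ∈ G, ∀ q ∈ G, |p.2 - q.2 - 5 / 4 * (p.1 - q.1)| ≤ 3 / 4 * |p.1 - q.1| := by
    intro p hp q hq
    by_cases h : p = q
    · simp [h]
    · rcases hG hp hq h with ⟨h1, h2⟩ | ⟨h1, h2⟩
      · rw [abs_of_neg (show p.1 - q.1 < 0 by linarith), abs_le]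
        constructor <;> linarith
      · rw [abs_of_pos (show 0 < p.1 - q.1 by linarith), abs_le]
        constructor <;> linarith
  choose! g hg using hGA
  have hgslope : ∀ x ∈ A, ∀ y ∈ A, |g x - g y - 5 / 4 * (x - y)| ≤ 3 / 4 * |x - y| :=
    fun x hx y hy => hGslope _ (hg x hx) _ (hg y hy)
  have hlip : LipschitzOnWith 2 g A := by
    refine LipschitzOnWith.of_dist_le_mul fun x hx y hy => ?_
    have h1 := hgslope x hx y hy
    have h2 := abs_add_le (g x - g y - 5 / 4 * (x - y)) (5 / 4 * (x - y))
    rw [sub_add_cancel, abs_mul, abs_of_pos (show (0 : ℝ) < 5 / 4 by norm_num)] at h2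
    rw [Real.dist_eq, Real.dist_eq, NNReal.coe_ofNat]
    linarith
  obtain ⟨f, hf, hfg⟩ := hlip.extend_real
  have hfc : Continuous f := hf.continuous
  have hfslope : ∀ x y, |f x - f y - 5 / 4 * (x - y)| ≤ 3 / 4 * |x - y| := by
    have hdr : DenseRange ((↑) : A → ℝ) := hA.denseRange_val
    refine isClosed_property2 hdr (p := fun x y => |f x - f y - 5 / 4 * (x - y)| ≤ 3 / 4 * |x - y|)
      (isClosed_le (by fun_prop) (by fun_prop)) fun x y => ?_
    rw [← hfg x.2, ← hfg y.2]
    exact hgslope x x.2 y y.2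
  have hfS : SlopeBounded f := by
    intro x y hxy
    have h := hfslope y x
    rw [abs_of_nonneg (sub_nonneg.2 hxy), abs_le] at h
    constructor <;> linarith
  have hfG : ∀ p ∈ G, f p.1 = p.2 := by
    intro p hp
    have h := hGslope _ (hg p.1 (hGAB hp).1) _ hp
    rw [← hfg (hGAB hp).1]
    simp only [sub_self, mul_zero, sub_zero, abs_zero] at h
    exact sub_eq_zero.1 (abs_eq_zero.1 (le_antisymm h (abs_nonneg _)))
  refine ⟨f, hfS, ?_, hfG (0, 0) (hFG (by simp [F])), hfG (1, 1) (hFG (by simp [F])), ?_⟩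
  · have hanti : AntilipschitzWith 2 f := AntilipschitzWith.of_le_mul_dist fun x y => by
      rw [Real.dist_eq, Real.dist_eq, NNReal.coe_ofNat]
      exact (hfS.abs_sub_le x y).1
    have hclosed : IsClosed (Set.range f) := hanti.isClosed_range hf.uniformContinuous
    have hBr : B ⊆ Set.range f := fun b hb => by
      obtain ⟨a, hab⟩ := hGB b hb
      exact ⟨a, hfG _ hab⟩
    rw [← Set.range_eq_univ, ← hclosed.closure_eq]
    exact (hB.mono hBr).closure_eq
  · intro x
    constructor <;> intro hx
    · obtain ⟨a, hab⟩ := hGB _ hx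
      rw [← hfS.injective (hfG _ hab)]
      exact (hGAB hab).1
    · rw [← hfg hx]
      exact (hGAB (hg x hx)).2

/-- The map commuting with integer translations that agrees with `f` on `[0, 1)`. -/
def periodize (f : ℝ → ℝ) (x : ℝ) : ℝ := ⌊x⌋ + f (Int.fract x)

theorem periodize_add_intCast (f : ℝ → ℝ) (x : ℝ) (n : ℤ) :
    periodize f (x + n) = periodize f x + n := by
  simp only [periodize, Int.floor_add_intCast, Int.fract_add_intCast, Int.cast_add]
  ring

theorem SlopeBounded.periodize {f : ℝ → ℝ} (hf : SlopeBounded f) (h0 : f 0 = 0) (h1 : f 1 = 1) :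
    SlopeBounded (periodize f) := by
  intro x y hxy
  have hx := Int.floor_add_fract x
  have hy := Int.floor_add_fract y
  simp only [_root_.periodize]
  rcases (Int.floor_mono hxy).eq_or_lt with h | h
  · rw [← h] at hy ⊢
    have := hf (Int.fract x) (Int.fract y) (by linarith)
    constructor <;> linarith
  · have hc : (⌊x⌋ : ℝ) + 1 ≤ ⌊y⌋ := by exact_mod_cast h
    have hfx := hf _ _ (Int.fract_lt_one x).le
    have hfy := hf _ _ (Int.fract_nonneg y)
    constructor <;> linarith

theorem SlopeBounded.surjective_periodize {f : ℝ → ℝ} (hf : SlopeBounded f)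
    (hs : Function.Surjective f) (h0 : f 0 = 0) (h1 : f 1 = 1) :
    Function.Surjective (_root_.periodize f) := by
  intro y
  obtain ⟨x, hx⟩ := hs (Int.fract y)
  have hx0 : 0 ≤ x := hf.le_iff_le.1 (by rw [h0, hx]; exact Int.fract_nonneg y)
  have hx1 : x < 1 := hf.lt_iff_lt.1 (by rw [h1, hx]; exact Int.fract_lt_one y)
  refine ⟨x + ⌊y⌋, ?_⟩
  rw [periodize_add_intCast, _root_.periodize, Int.floor_eq_zero_iff.2 ⟨hx0, hx1⟩,
    Int.fract_eq_self.2 ⟨hx0, hx1⟩, hx, Int.cast_zero, zero_add, Int.fract_add_floor]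

theorem tc_surjective : Function.Surjective tc := QuotientAddGroup.mk_surjective

theorem tc_eq_tc_iff {x y : ℝ} : tc x = tc y ↔ ∃ n : ℤ, y = x + n := by
  rw [eq_comm, tc, tc, ← sub_eq_zero, ← AddCircle.coe_sub, AddCircle.coe_eq_zero_iff]
  simp only [zsmul_eq_mul, mul_one]
  exact exists_congr fun n => by rw [eq_sub_iff_add_eq, add_comm, eq_comm]

theorem dist_tc (x y : ℝ) : dist (tc x) (tc y) = |x - y - round (x - y)| := by
  rw [tc, tc, dist_eq_norm, ← AddCircle.coe_sub, UnitAddCircle.norm_eq]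

theorem exists_dist_tc_eq (x y : ℝ) : ∃ n : ℤ, dist (tc x) (tc y) = |x - (y + n)| :=
  ⟨round (x - y), by rw [dist_tc, sub_sub]⟩

theorem dist_tc_le (x y : ℝ) (n : ℤ) : dist (tc x) (tc y) ≤ |x - (y + n)| := by
  rw [dist_tc, ← sub_sub]
  exact round_le _ _

/-- A bi-Lipschitz homeomorphism of the line commuting with integer translations descends to a
bi-Lipschitz homeomorphism of the circle. -/
theorem SlopeBounded.exists_circle_homeomorph {h : ℝ → ℝ} (hh : SlopeBounded h)
    (hs : Function.Surjective h) (hp : ∀ (x : ℝ) (n : ℤ), h (x + n) = h x + n) :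
    ∃ φ : 𝕊 ≃ₜ 𝕊, (∀ x, φ (tc x) = tc (h x)) ∧
      ∀ x y, dist x y ≤ 2 * dist (φ x) (φ y) ∧ dist (φ x) (φ y) ≤ 2 * dist x y := by
  have hper : Function.Periodic (fun x => tc (h x)) 1 := fun x => by
    have := hp x 1
    rw [Int.cast_one] at this
    exact tc_eq_tc_iff.2 ⟨-1, by rw [this]; push_cast; ring⟩
  let φ : 𝕊 → 𝕊 := hper.lift
  have hφ : ∀ x, φ (tc x) = tc (h x) := fun x => hper.lift_coe x
  have hbi : ∀ x y, dist x y ≤ 2 * dist (φ x) (φ y) ∧ dist (φ x) (φ y) ≤ 2 * dist x y := by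
    intro x y
    obtain ⟨x, rfl⟩ := tc_surjective x
    obtain ⟨y, rfl⟩ := tc_surjective y
    rw [hφ, hφ]
    constructor
    · obtain ⟨n, hn⟩ := exists_dist_tc_eq (h x) (h y)
      rw [hn, ← hp]
      exact (dist_tc_le x y n).trans (hh.abs_sub_le _ _).1
    · obtain ⟨n, hn⟩ := exists_dist_tc_eq x y
      have := dist_tc_le (h x) (h y) n
      rw [← hp] at this
      rw [hn]
      exact this.trans (hh.abs_sub_le _ _).2
  have hcont : Continuous φ := (LipschitzWith.of_dist_le_mul (K := 2) fun x y => by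
    rw [NNReal.coe_ofNat]; exact (hbi x y).2).continuous
  have hinj : Function.Injective φ := fun x y hxy => by
    have := (hbi x y).1
    rw [hxy, dist_self, mul_zero] at this
    exact dist_le_zero.1 this
  have hsurj : Function.Surjective φ := fun y => by
    obtain ⟨y, rfl⟩ := tc_surjective y
    obtain ⟨x, rfl⟩ := hs y
    exact ⟨tc x, hφ x⟩
  have : Fact ((0 : ℝ) < 1) := ⟨one_pos⟩
  exact ⟨Continuous.homeoOfEquivCompactToT2 (f := Equiv.ofBijective φ ⟨hinj, hsurj⟩) hcont,
    hφ, hbi⟩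

theorem quasiSymmetric_of_bilipschitz {φ : 𝕊 → 𝕊}
    (hφ : ∀ x y, dist x y ≤ 2 * dist (φ x) (φ y) ∧ dist (φ x) (φ y) ≤ 2 * dist x y) :
    QuasiSymmetric φ := by
  refine ⟨Homeomorph.mulLeft₀ (4 : ℝ≥0) four_ne_zero, fun s t hst => ?_, fun x y z hxz => ?_⟩
  · simpa using hst
  · have hpos : 0 < dist x z := dist_pos.2 hxz
    simp only [Homeomorph.coe_mulLeft₀, NNReal.coe_mul, NNReal.coe_ofNat,
      Real.coe_toNNReal _ (div_nonneg dist_nonneg hpos.le)]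
    calc dist (φ x) (φ y) ≤ 2 * dist x y := (hφ x y).2
      _ = 2 * (dist x y / dist x z) * dist x z := by field_simp
      _ ≤ 2 * (dist x y / dist x z) * (2 * dist (φ x) (φ z)) := by
        gcongr
        exact (hφ x z).1
      _ = 4 * (dist x y / dist x z) * dist (φ x) (φ z) := by ring

theorem adicPoints_eq_image (d : ℕ) : adicPoints d = tc '' adicReals d := by
  ext x
  constructor
  · rintro ⟨p, n, rfl⟩
    exact ⟨_, ⟨p, n, rfl⟩, rfl⟩
  · rintro ⟨_, ⟨p, n, rfl⟩, rfl⟩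
    exact ⟨p, n, rfl⟩

theorem intCast_mem_adicReals (d : ℕ) (n : ℤ) : (n : ℝ) ∈ adicReals d :=
  ⟨n, 0, by simp⟩

theorem countable_adicReals (d : ℕ) : (adicReals d).Countable := by
  refine (Set.countable_range fun q : ℤ × ℕ => (q.1 : ℝ) / d ^ q.2).mono ?_
  rintro _ ⟨p, n, rfl⟩
  exact ⟨(p, n), rfl⟩

theorem dense_adicReals {d : ℕ} (hd : 2 ≤ d) : Dense (adicReals d) := by
  refine dense_of_exists_between fun a b hab => ?_
  have hd1 : (1 : ℝ) < d := by exact_mod_cast hd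
  obtain ⟨n, hn⟩ := pow_unbounded_of_one_lt (b - a)⁻¹ hd1
  have hpos : (0 : ℝ) < d ^ n := by positivity
  have hn' : 1 < (b - a) * d ^ n := (inv_lt_iff_one_lt_mul₀' (sub_pos.2 hab)).1 hn
  refine ⟨_, ⟨⌊a * d ^ n⌋ + 1, n, rfl⟩, ?_, ?_⟩
  · rw [lt_div_iff₀ hpos]
    push_cast
    exact Int.lt_floor_add_one _
  · rw [div_lt_iff₀ hpos]
    push_cast
    linarith [Int.floor_le (a * (d : ℝ) ^ n)]

theorem add_intCast_mem_adicReals_iff {d : ℕ} (hd : 2 ≤ d) {x : ℝ} (n : ℤ) :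
    x + n ∈ adicReals d ↔ x ∈ adicReals d := by
  have key : ∀ (x : ℝ) (n : ℤ), x ∈ adicReals d → x + n ∈ adicReals d := by
    rintro _ n ⟨p, m, rfl⟩
    have : (d : ℝ) ≠ 0 := by positivity
    exact ⟨p + n * d ^ m, m, by push_cast; field_simp⟩
  refine ⟨fun h => ?_, key x n⟩
  simpa using key _ (-n) h

theorem periodize_mem_adicReals_iff {d e : ℕ} (hd : 2 ≤ d) (he : 2 ≤ e) {f : ℝ → ℝ}
    (hf : ∀ x, f x ∈ adicReals e ↔ x ∈ adicReals d) (x : ℝ) :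
    periodize f x ∈ adicReals e ↔ x ∈ adicReals d := by
  rw [periodize, add_comm, add_intCast_mem_adicReals_iff he, hf,
    ← add_intCast_mem_adicReals_iff hd ⌊x⌋, Int.fract_add_floor]

/-- For any integers `d, e ≥ 2` there is a quasisymmetric homeomorphism `φ : ℝ/ℤ → ℝ/ℤ`
mapping the set of `d`-adic rationals onto the set of `e`-adic rationals. -/
theorem exists_quasisymmetric_dadic_to_eadic (d e : ℕ) (hd : 2 ≤ d) (he : 2 ≤ e) :
    ∃ φ : 𝕊 ≃ₜ 𝕊, QuasiSymmetric φ ∧ ⇑φ '' adicPoints d = adicPoints e := by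
  have h0 (k : ℕ) : (0 : ℝ) ∈ adicReals k := by simpa using intCast_mem_adicReals k 0
  have h1 (k : ℕ) : (1 : ℝ) ∈ adicReals k := by simpa using intCast_mem_adicReals k 1
  obtain ⟨f, hf, hfs, hf0, hf1, hfA⟩ := exists_slopeBounded (countable_adicReals d)
    (countable_adicReals e) (dense_adicReals hd) (dense_adicReals he) (h0 d) (h1 d) (h0 e) (h1 e)
  have hs := hf.surjective_periodize hfs hf0 hf1
  have hA := periodize_mem_adicReals_iff hd he hfA
  obtain ⟨φ, hφ, hbi⟩ := (hf.periodize hf0 hf1).exists_circle_homeomorph hs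
    (periodize_add_intCast f)
  refine ⟨φ, quasiSymmetric_of_bilipschitz hbi, ?_⟩
  rw [adicPoints_eq_image, adicPoints_eq_image, Set.image_image]
  ext y
  constructor
  · rintro ⟨x, hx, rfl⟩
    exact ⟨_, (hA x).2 hx, (hφ x).symm⟩
  · rintro ⟨z, hz, rfl⟩
    obtain ⟨x, rfl⟩ := hs z
    exact ⟨x, (hA x).1 hz, hφ x⟩
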